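/- Let b : ℝ → ℝ be C², let c > 0, and let γ : ℝ × [0,c] → ℝ be C². Suppose that for every smooth compactly supported ζ : ℝ × (0,c) → ℝ, the derivative at ε = 0 of ε ↦ ∫₀ᶜ ∫_ℝ [ b(∂ₜγ + ε ∂ₜζ)·(∂ₓγ + ε ∂ₓζ) − b(∂ₜγ)·∂ₓγ ] dx dt vanishes. Then ∂ₓγ · b''(∂ₜγ) · ∂ₜₜγ + 2 b'(∂ₜγ) · ∂ₜ∂ₓγ = 0 at every point of ℝ × (0,c). -/

import Mathlib

open MeasureTheory

lemma aux_dt (G : ℝ × ℝ → ℝ) (x t : ℝ) (h : DifferentiableAt ℝ G (x, t)) :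
    HasDerivAt (fun s => G (x, s)) (fderiv ℝ G (x, t) (0, 1)) t := by
  have h2 : HasDerivAt (fun s : ℝ => (x, s)) ((0 : ℝ), (1 : ℝ)) t :=
    (hasDerivAt_const t x).prodMk (hasDerivAt_id t)
  exact HasFDerivAt.comp_hasDerivAt t (f := fun s : ℝ => (x, s)) h.hasFDerivAt h2

lemma aux_dx (G : ℝ × ℝ → ℝ) (x t : ℝ) (h : DifferentiableAt ℝ G (x, t)) :
    HasDerivAt (fun y => G (y, t)) (fderiv ℝ G (x, t) (1, 0)) x := by
  have h2 : HasDerivAt (fun y : ℝ => (y, t)) ((1 : ℝ), (0 : ℝ)) x :=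
    (hasDerivAt_id x).prodMk (hasDerivAt_const x t)
  exact HasFDerivAt.comp_hasDerivAt x (f := fun y : ℝ => (y, t)) h.hasFDerivAt h2

lemma aux_integrable (F : ℝ × ℝ → ℝ) (K : Set (ℝ × ℝ)) (hK : IsCompact K)
    (hF : Continuous F) (h0 : ∀ z, z ∉ K → F z = 0) : Integrable F :=
  hF.integrable_of_hasCompactSupport (HasCompactSupport.intro hK h0)

lemma aux_fubini (F : ℝ × ℝ → ℝ) (K : Set (ℝ × ℝ)) (hK : IsCompact K) (c : ℝ)
    (hKc : K ⊆ Set.univ ×ˢ Set.Ioo 0 c)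
    (hF : Continuous F) (h0 : ∀ z, z ∉ K → F z = 0) :
    ∫ t in Set.Ioo (0:ℝ) c, ∫ x : ℝ, F (x, t) = ∫ z, F z := by
  rw [setIntegral_eq_integral_of_forall_compl_eq_zero]
  · rw [Measure.volume_eq_prod, integral_prod_symm]
    exact aux_integrable F K hK hF h0
  · intro t ht
    have : ∀ x, F (x, t) = 0 := fun x => h0 _ fun hx => ht (hKc hx).2
    simp [this]

lemma aux_deriv (b : ℝ → ℝ) (hb : ContDiff ℝ 2 b) (P Q T X : ℝ × ℝ → ℝ)
    (hP : Continuous P) (hQ : Continuous Q) (hT : Continuous T) (hX : Continuous X)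
    (K : Set (ℝ × ℝ)) (hK : IsCompact K)
    (hT0 : ∀ z, z ∉ K → T z = 0) (hX0 : ∀ z, z ∉ K → X z = 0) :
    HasDerivAt (fun ε : ℝ => ∫ z, (b (P z + ε * T z) * (Q z + ε * X z) - b (P z) * Q z))
      (∫ z, ((deriv b (P z) * Q z) * T z + b (P z) * X z)) 0 := by
  have hbc : Continuous b := hb.continuous
  have hb' : Continuous (deriv b) := hb.continuous_deriv (by norm_num)
  have hbd : Differentiable ℝ b := hb.differentiable (by norm_num)
  let F' : ℝ → ℝ × ℝ → ℝ := fun ε z =>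
    deriv b (P z + ε * T z) * T z * (Q z + ε * X z) + b (P z + ε * T z) * X z
  have hF'c : Continuous (fun p : ℝ × (ℝ × ℝ) => F' p.1 p.2) := by
    simp only [F']; fun_prop
  obtain ⟨C, hC⟩ := ((isCompact_Icc (a := (-1:ℝ)) (b := 1)).prod hK).exists_bound_of_continuousOn
    hF'c.continuousOn
  have key := hasDerivAt_integral_of_dominated_loc_of_deriv_le (μ := (volume : Measure (ℝ × ℝ)))
    (F := fun ε z => (b (P z + ε * T z) * (Q z + ε * X z) - b (P z) * Q z))
    (F' := F') (x₀ := (0:ℝ)) (s := Set.Icc (-1) 1) (bound := K.indicator fun _ => C)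
    (Icc_mem_nhds (by norm_num) (by norm_num)) ?_ ?_ ?_ ?_ ?_ ?_
  · have h := key.2
    have he : ∫ z, ((deriv b (P z) * Q z) * T z + b (P z) * X z) = ∫ z, F' 0 z := by
      refine integral_congr_ae (Filter.Eventually.of_forall fun z => ?_)
      simp only [F', zero_mul, add_zero]
      ring
    rw [he]
    exact h
  · refine Filter.Eventually.of_forall fun ε => Continuous.aestronglyMeasurable ?_
    fun_prop
  · simp
  · exact (hF'c.comp (by fun_prop : Continuous fun z : ℝ × ℝ => ((0:ℝ), z))).aestronglyMeasurable
  · refine Filter.Eventually.of_forall fun z ε hε => ?_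
    by_cases hz : z ∈ K
    · simpa [hz] using hC (ε, z) ⟨hε, hz⟩
    · simp [hz, F', hT0 z hz, hX0 z hz]
  · rw [integrable_indicator_iff hK.measurableSet]
    exact integrableOn_const hK.measure_lt_top.ne
  · refine Filter.Eventually.of_forall fun z ε _ => ?_
    have h1 : HasDerivAt (fun ε : ℝ => P z + ε * T z) (T z) ε := by
      simpa using ((hasDerivAt_id ε).mul_const (T z)).const_add (P z)
    have h2 : HasDerivAt (fun ε : ℝ => Q z + ε * X z) (X z) ε := by
      simpa using ((hasDerivAt_id ε).mul_const (X z)).const_add (Q z)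
    have h3 := HasDerivAt.comp ε (hbd (P z + ε * T z)).hasDerivAt h1
    exact (h3.mul h2).sub_const _

lemma aux_parts (f g : ℝ × ℝ → ℝ) (hf : ContDiff ℝ 1 f) (hg : ContDiff ℝ 1 g)
    (hgc : HasCompactSupport g) (v : ℝ × ℝ) :
    Integrable (fun z => f z * fderiv ℝ g z v) ∧ Integrable (fun z => fderiv ℝ f z v * g z) ∧
    ∫ z, f z * fderiv ℝ g z v = - ∫ z, fderiv ℝ f z v * g z := by
  have hf' : Continuous (fun z => fderiv ℝ f z v) :=
    (hf.continuous_fderiv (by norm_num)).clm_apply continuous_const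
  have hg' : Continuous (fun z => fderiv ℝ g z v) :=
    (hg.continuous_fderiv (by norm_num)).clm_apply continuous_const
  have i1 : Integrable (fun z => f z * fderiv ℝ g z v) :=
    (hf.continuous.mul hg').integrable_of_hasCompactSupport ((hgc.fderiv_apply ℝ v).mul_left)
  have i2 : Integrable (fun z => fderiv ℝ f z v * g z) :=
    (hf'.mul hg.continuous).integrable_of_hasCompactSupport hgc.mul_left
  have i3 : Integrable (fun z => f z * g z) :=
    (hf.continuous.mul hg.continuous).integrable_of_hasCompactSupport hgc.mul_left
  exact ⟨i1, i2, integral_mul_fderiv_eq_neg_fderiv_mul_of_integrable i2 i1 i3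
    (fun z _ => hf.differentiable (by norm_num) z) (fun z _ => hg.differentiable (by norm_num) z)⟩

/-- If the first variation of the action `∫₀ᶜ∫ b(γ_t) γ_x dx dt` vanishes at `γ`
in every smooth direction `ζ` compactly supported in `ℝ × (0,c)`, then `γ` satisfies the
Euler–Lagrange equation `γ_x b''(γ_t) γ_tt + 2 b'(γ_t) γ_tx = 0` on `ℝ × (0,c)`. -/
theorem stmt2
    (b : ℝ → ℝ) (c : ℝ) (γ : ℝ → ℝ → ℝ)
    (hb : ContDiff ℝ 2 b) (hc : 0 < c)
    (hγ : ContDiff ℝ 2 (Function.uncurry γ))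
    (hcrit : ∀ ζ : ℝ → ℝ → ℝ, ContDiff ℝ (⊤ : ℕ∞) (Function.uncurry ζ) →
      HasCompactSupport (Function.uncurry ζ) →
      tsupport (Function.uncurry ζ) ⊆ Set.univ ×ˢ Set.Ioo 0 c →
      deriv (fun ε : ℝ => ∫ t in Set.Ioo (0:ℝ) c, ∫ x : ℝ,
        (b (deriv (γ x) t + ε * deriv (ζ x) t)
            * (deriv (fun y => γ y t) x + ε * deriv (fun y => ζ y t) x)
          - b (deriv (γ x) t) * deriv (fun y => γ y t) x)) 0 = 0) :
    ∀ x t : ℝ, t ∈ Set.Ioo 0 c →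
      deriv (fun y => γ y t) x * deriv (deriv b) (deriv (γ x) t) *
          deriv (deriv (γ x)) t
        + 2 * deriv b (deriv (γ x) t) *
          deriv (fun s => deriv (fun y => γ y s) x) t = 0 := by
  set G := Function.uncurry γ with hG
  let P : ℝ × ℝ → ℝ := fun z => fderiv ℝ G z (0, 1)
  let Q : ℝ × ℝ → ℝ := fun z => fderiv ℝ G z (1, 0)
  have hG1 : ContDiff ℝ 1 (fderiv ℝ G) := hγ.fderiv_right (by norm_num)
  have hGd : Differentiable ℝ G := hγ.differentiable (by norm_num)
  have hP : ContDiff ℝ 1 P := hG1.clm_apply contDiff_const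
  have hQ : ContDiff ℝ 1 Q := hG1.clm_apply contDiff_const
  have hPd : Differentiable ℝ P := hP.differentiable (by norm_num)
  have hQd : Differentiable ℝ Q := hQ.differentiable (by norm_num)
  have hb1 : ContDiff ℝ 1 b := hb.of_le (by norm_num)
  have hb' : ContDiff ℝ 1 (deriv b) := by
    have : ContDiff ℝ (1 + 1) b := by simpa [one_add_one_eq_two] using hb
    exact (contDiff_succ_iff_deriv.1 this).2.2
  have ePt : ∀ x t, deriv (γ x) t = P (x, t) := fun x t => (aux_dt G x t (hGd _)).deriv
  have eQx : ∀ x t, deriv (fun y => γ y t) x = Q (x, t) := fun x t => (aux_dx G x t (hGd _)).deriv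
  let A : ℝ × ℝ → ℝ := fun z => deriv b (P z) * Q z
  let B : ℝ × ℝ → ℝ := fun z => b (P z)
  have hA : ContDiff ℝ 1 A := (hb'.comp hP).mul hQ
  have hB : ContDiff ℝ 1 B := hb1.comp hP
  let E : ℝ × ℝ → ℝ := fun z => fderiv ℝ A z (0, 1) + fderiv ℝ B z (1, 0)
  have hE : Continuous E :=
    ((hA.continuous_fderiv (by norm_num)).clm_apply continuous_const).add
      ((hB.continuous_fderiv (by norm_num)).clm_apply continuous_const)
  have hU : IsOpen ((Set.univ : Set ℝ) ×ˢ Set.Ioo (0:ℝ) c) := isOpen_univ.prod isOpen_Ioo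
  have hae : ∀ᵐ z ∂(volume : Measure (ℝ × ℝ)),
      z ∈ (Set.univ : Set ℝ) ×ˢ Set.Ioo (0:ℝ) c → E z = 0 := by
    refine hU.ae_eq_zero_of_integral_contDiff_smul_eq_zero
      (hE.locallyIntegrable.locallyIntegrableOn _) ?_
    intro g hg hgc hgs
    have hg1 : ContDiff ℝ 1 g := hg.of_le (by exact_mod_cast le_top)
    have hgd : Differentiable ℝ g := hg1.differentiable (by norm_num)
    have h := hcrit (fun x t => g (x, t)) hg hgc hgs
    have eT : ∀ x t, deriv (fun s => g (x, s)) t = fderiv ℝ g (x, t) (0, 1) :=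
      fun x t => (aux_dt g x t (hgd _)).deriv
    have eX : ∀ x t, deriv (fun y => g (y, t)) x = fderiv ℝ g (x, t) (1, 0) :=
      fun x t => (aux_dx g x t (hgd _)).deriv
    have hT : Continuous (fun z => fderiv ℝ g z (0, 1)) :=
      (hg1.continuous_fderiv (by norm_num)).clm_apply continuous_const
    have hX : Continuous (fun z => fderiv ℝ g z (1, 0)) :=
      (hg1.continuous_fderiv (by norm_num)).clm_apply continuous_const
    have h0 : ∀ v z, z ∉ tsupport g → fderiv ℝ g z v = 0 := by
      intro v z hz
      have : fderiv ℝ g z = 0 := by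
        by_contra hne
        exact hz (support_fderiv_subset ℝ hne)
      simp [this]
    simp only [ePt, eQx, eT, eX] at h
    have hfun : ∀ ε : ℝ, (∫ t in Set.Ioo (0:ℝ) c, ∫ x : ℝ,
        (b (P (x, t) + ε * fderiv ℝ g (x, t) (0, 1))
            * (Q (x, t) + ε * fderiv ℝ g (x, t) (1, 0)) - b (P (x, t)) * Q (x, t)))
        = ∫ z, (b (P z + ε * fderiv ℝ g z (0, 1))
            * (Q z + ε * fderiv ℝ g z (1, 0)) - b (P z) * Q z) := by
      intro ε
      refine aux_fubini (fun z => b (P z + ε * fderiv ℝ g z (0, 1))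
            * (Q z + ε * fderiv ℝ g z (1, 0)) - b (P z) * Q z) (tsupport g) hgc c hgs ?_ ?_
      · have := hb.continuous
        have := hP.continuous
        have := hQ.continuous
        fun_prop
      · intro z hz
        simp [h0 _ z hz]
    simp only [hfun] at h
    rw [(aux_deriv b hb P Q _ _ hP.continuous hQ.continuous hT hX (tsupport g) hgc
      (h0 _) (h0 _)).deriv] at h
    obtain ⟨a1, a2, a3⟩ := aux_parts A g hA hg1 hgc (0, 1)
    obtain ⟨b1, b2, b3⟩ := aux_parts B g hB hg1 hgc (1, 0)
    have h2 := integral_add a1 b1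
    have h3 := integral_add a2 b2
    have h4 : ∫ z, g z • E z = ∫ z, (fderiv ℝ A z (0, 1) * g z + fderiv ℝ B z (1, 0) * g z) := by
      congr 1
      ext z
      simp only [E, smul_eq_mul]
      ring
    rw [h4, h3]
    have h5 := h2.symm.trans h
    linarith
  have hEz : ∀ z ∈ (Set.univ : Set ℝ) ×ˢ Set.Ioo (0:ℝ) c, E z = 0 := by
    have := Measure.eqOn_open_of_ae_eq (μ := (volume : Measure (ℝ × ℝ))) (f := E)
      (g := fun _ => (0:ℝ)) ((ae_restrict_iff' hU.measurableSet).2 hae) hU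
      hE.continuousOn continuousOn_const
    exact this
  intro x t ht
  have hz := hEz (x, t) ⟨Set.mem_univ _, ht⟩
  have hPt := aux_dt P x t (hPd _)
  have hPx := aux_dx P x t (hPd _)
  have hQt := aux_dt Q x t (hQd _)
  have hsymm : fderiv ℝ P (x, t) (1, 0) = fderiv ℝ Q (x, t) (0, 1) := by
    have hs : IsSymmSndFDerivAt ℝ G (x, t) := hγ.contDiffAt.isSymmSndFDerivAt (by simp)
    have hd : DifferentiableAt ℝ (fderiv ℝ G) (x, t) := hG1.differentiable (by norm_num) _
    have e : ∀ v w : ℝ × ℝ, fderiv ℝ (fun z => fderiv ℝ G z v) (x, t) w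
        = fderiv ℝ (fderiv ℝ G) (x, t) w v := by
      intro v w
      rw [fderiv_clm_apply hd (differentiableAt_const v)]
      simp
    exact (e _ _).trans ((hs _ _).trans (e _ _).symm)
  have hA' : fderiv ℝ A (x, t) (0, 1) = deriv (deriv b) (P (x, t)) * fderiv ℝ P (x, t) (0, 1)
      * Q (x, t) + deriv b (P (x, t)) * fderiv ℝ Q (x, t) (0, 1) := by
    have h1 := aux_dt A x t (hA.differentiable (by norm_num) _)
    have h2 := HasDerivAt.comp t (h₂ := deriv b)
      (hb'.differentiable (by norm_num) (P (x, t))).hasDerivAt hPt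
    exact h1.unique (h2.mul hQt)
  have hB' : fderiv ℝ B (x, t) (1, 0) = deriv b (P (x, t)) * fderiv ℝ P (x, t) (1, 0) := by
    have h1 := aux_dx B x t (hB.differentiable (by norm_num) _)
    have h2 := HasDerivAt.comp x (h₂ := b)
      (hb1.differentiable (by norm_num) (P (x, t))).hasDerivAt hPx
    exact h1.unique h2
  have eP : deriv (γ x) = fun s => P (x, s) := funext fun s => ePt x s
  simp only [eQx]
  rw [eP, hPt.deriv, hQt.deriv]
  simp only [E] at hz
  rw [hA', hB', hsymm] at hz
  linarith
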